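/- The following conditions are equivalent for a closed subset Z of ℝ^{ω₁}: (i) Z is a Z_{ω₁}-set in ℝ^{ω₁}; (ii) Z contains no nonempty G_δ-subset of ℝ^{ω₁}. -/

import Mathlib

open Set Topology

/-- A subset `U` of a topological space is functionally open (a cozero set). -/
def FunctionallyOpen {X : Type*} [TopologicalSpace X] (U : Set X) : Prop :=
  ∃ φ : X → ℝ, Continuous φ ∧ U = φ ⁻¹' {(0 : ℝ)}ᶜ

/-- A countable cover by functionally open sets. -/
def IsCFOCover {X : Type*} [TopologicalSpace X] (𝒰 : Set (Set X)) : Prop :=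
  𝒰.Countable ∧ (∀ U ∈ 𝒰, FunctionallyOpen U) ∧ ⋃₀ 𝒰 = Set.univ

/-- Two maps are `𝒰`-close if every point's images lie in a common member of `𝒰`. -/
def UClose {X Y : Type*} (𝒰 : Set (Set Y)) (f g : X → Y) : Prop :=
  ∀ x, ∃ U ∈ 𝒰, f x ∈ U ∧ g x ∈ U

/-- Two sets are functionally separated if some continuous `[0,1]`-valued function
is `0` on the first and `1` on the second. -/
def FunctionallySeparated {X : Type*} [TopologicalSpace X] (P Q : Set X) : Prop :=
  ∃ φ : X → ℝ, Continuous φ ∧ (∀ x, φ x ∈ Set.Icc (0 : ℝ) 1) ∧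
    (∀ p ∈ P, φ p = 0) ∧ (∀ q ∈ Q, φ q = 1)

/-- `Z` is a `Z_τ`-set in `X`. -/
def ZTauSet {X : Type} [TopologicalSpace X] (τ : Cardinal.{0}) (Z : Set X) : Prop :=
  IsClosed Z ∧ ∀ g : X → X, Continuous g →
    ∀ 𝒞 : Set (Set (Set X)), Cardinal.mk ↥𝒞 < τ → (∀ 𝒰 ∈ 𝒞, IsCFOCover 𝒰) →
      ∃ f : X → X, Continuous f ∧ (∀ 𝒰 ∈ 𝒞, UClose 𝒰 f g) ∧
        FunctionallySeparated (Set.range f) Z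

/-- The open box in `A → ℝ` cut out by finitely many constraints `p < x a < q` with rational
`p` and `q`. -/
def ratBox {A : Type*} (t : Finset (A × ℚ × ℚ)) : Set (A → ℝ) :=
  {x | ∀ p ∈ t, (p.2.1 : ℝ) < x p.1 ∧ x p.1 < p.2.2}

/-- A box is free in `V` if it can be cut down to a subset of `V` by constraints avoiding any
prescribed countable set of coordinates. -/
def FreeIn {A : Type*} (V : Set (A → ℝ)) (t : Finset (A × ℚ × ℚ)) : Prop :=
  ∀ C : Set A, C.Countable → ∃ u : Finset (A × ℚ × ℚ), (∀ p ∈ u, p.1 ∉ C) ∧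
    (ratBox u).Nonempty ∧ ratBox t ∩ ratBox u ⊆ V

theorem isOpen_ratBox {A : Type*} (t : Finset (A × ℚ × ℚ)) : IsOpen (ratBox t) := by
  have h : ratBox t = ⋂ p ∈ t, {x : A → ℝ | (p.2.1 : ℝ) < x p.1 ∧ x p.1 < p.2.2} := by
    ext x; simp [ratBox]
  rw [h]
  refine isOpen_biInter_finset fun p _ => ?_
  exact (isOpen_lt continuous_const (continuous_apply p.1)).inter
    (isOpen_lt (continuous_apply p.1) continuous_const)

theorem ratBox_congr {A : Type*} {t : Finset (A × ℚ × ℚ)} {x y : A → ℝ}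
    (h : ∀ p ∈ t, y p.1 = x p.1) (hx : x ∈ ratBox t) : y ∈ ratBox t := by
  intro p hp
  rw [h p hp]
  exact hx p hp

theorem exists_ratBox_subset {A : Type*} {V : Set (A → ℝ)} (hV : IsOpen V) {z : A → ℝ}
    (hz : z ∈ V) : ∃ t, z ∈ ratBox t ∧ ratBox t ⊆ V := by
  classical
  obtain ⟨I, u, hu, hI⟩ := isOpen_pi_iff.1 hV z hz
  have key : ∀ a, ∃ p q : ℚ, a ∈ I → (p : ℝ) < z a ∧ z a < q ∧ Ioo (p : ℝ) q ⊆ u a := by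
    intro a
    by_cases ha : a ∈ I
    · obtain ⟨l, r, hlr, hs⟩ :=
        mem_nhds_iff_exists_Ioo_subset.1 ((hu a ha).1.mem_nhds (hu a ha).2)
      obtain ⟨p, hp, hp'⟩ := exists_rat_btwn hlr.1
      obtain ⟨q, hq, hq'⟩ := exists_rat_btwn hlr.2
      exact ⟨p, q, fun _ => ⟨hp', hq, (Ioo_subset_Ioo hp.le hq'.le).trans hs⟩⟩
    · exact ⟨0, 0, fun h => absurd h ha⟩
  choose p q hpq using key
  refine ⟨I.image fun a => (a, p a, q a), ?_, fun x hx => hI fun a ha => ?_⟩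
  · intro b hb
    obtain ⟨a, ha, rfl⟩ := Finset.mem_image.1 hb
    exact ⟨(hpq a ha).1, (hpq a ha).2.1⟩
  · exact (hpq a ha).2.2 (hx (a, p a, q a) (Finset.mem_image_of_mem _ ha))

theorem countable_setOf_supported {A : Type*} {S : Set A} (hS : S.Countable) :
    {t : Finset (A × ℚ × ℚ) | ∀ p ∈ t, p.1 ∈ S}.Countable := by
  have h := countable_ofPred_finite_subset (hS.prod (countable_univ (α := ℚ × ℚ)))
  refine (h.preimage (f := fun t : Finset (A × ℚ × ℚ) => (t : Set (A × ℚ × ℚ)))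
    Finset.coe_injective).mono fun t ht => ?_
  exact ⟨t.finite_toSet, fun p hp => ⟨ht p hp, mem_univ _⟩⟩

theorem exists_countable_closed {A : Type*} (c : Finset (A × ℚ × ℚ) → Set A)
    (hc : ∀ t, (c t).Countable) {B₀ : Set A} (hB₀ : B₀.Countable) :
    ∃ B, B₀ ⊆ B ∧ B.Countable ∧ ∀ t, (∀ p ∈ t, p.1 ∈ B) → c t ⊆ B := by
  classical
  let step : Set A → Set A := fun S => S ∪ ⋃ t ∈ {t | ∀ p ∈ t, p.1 ∈ S}, c t
  let D : ℕ → Set A := fun n => step^[n] B₀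
  have hD : ∀ n, D (n + 1) = step (D n) := fun n => Function.iterate_succ_apply' _ _ _
  have hmono : Monotone D := monotone_nat_of_le_succ fun n => by
    rw [hD]; exact subset_union_left
  have hcount : ∀ n, (D n).Countable := by
    intro n
    induction n with
    | zero => exact hB₀
    | succ n ih =>
      rw [hD]
      exact ih.union ((countable_setOf_supported ih).biUnion fun t _ => hc t)
  refine ⟨⋃ n, D n, subset_iUnion D 0, countable_iUnion hcount, fun t ht => ?_⟩
  have hn : ∃ n, ∀ p ∈ t, p.1 ∈ D n := by
    have hex : ∀ p, ∃ n, p ∈ t → p.1 ∈ D n := by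
      intro p
      by_cases hp : p ∈ t
      · obtain ⟨n, hn⟩ := mem_iUnion.1 (ht p hp)
        exact ⟨n, fun _ => hn⟩
      · exact ⟨0, fun h => absurd h hp⟩
    choose n hn using hex
    exact ⟨t.sup n, fun p hp => hmono (Finset.le_sup hp) (hn p hp)⟩
  obtain ⟨n, hn⟩ := hn
  refine Subset.trans ?_ (subset_iUnion D (n + 1))
  rw [hD]
  exact subset_union_of_subset_right
    (subset_biUnion_of_mem (u := c) (show t ∈ {t | ∀ p ∈ t, p.1 ∈ D n} from hn)) _

/-- Up to enlarging a countable set of coordinates, every point of an open set lies in a box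
which is free in it and only constrains those coordinates. -/
theorem exists_countable_freeIn {A : Type*} {V : Set (A → ℝ)} (hV : IsOpen V) {B₀ : Set A}
    (hB₀ : B₀.Countable) : ∃ B, B₀ ⊆ B ∧ B.Countable ∧
      ∀ z ∈ V, ∃ t, (∀ p ∈ t, p.1 ∈ B) ∧ z ∈ ratBox t ∧ FreeIn V t := by
  classical
  have hex : ∀ t, ∃ C : Set A, C.Countable ∧ (¬ FreeIn V t →
      ∀ u : Finset (A × ℚ × ℚ), (∀ p ∈ u, p.1 ∉ C) → (ratBox u).Nonempty →
        ¬ ratBox t ∩ ratBox u ⊆ V) := by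
    intro t
    by_cases ht : FreeIn V t
    · exact ⟨∅, countable_empty, fun h => absurd ht h⟩
    · have ht' := ht
      unfold FreeIn at ht'
      push Not at ht'
      obtain ⟨C, hC, h⟩ := ht'
      exact ⟨C, hC, fun _ => h⟩
  choose c hc hfree using hex
  obtain ⟨B, hB, hBc, hcl⟩ := exists_countable_closed c hc hB₀
  refine ⟨B, hB, hBc, fun z hz => ?_⟩
  obtain ⟨t, hzt, htV⟩ := exists_ratBox_subset hV hz
  refine ⟨t.filter (·.1 ∈ B), fun p hp => (Finset.mem_filter.1 hp).2,
    fun p hp => hzt p (Finset.mem_filter.1 hp).1, ?_⟩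
  by_contra hnot
  refine hfree _ hnot (t.filter (·.1 ∉ B)) (fun p hp hpc => (Finset.mem_filter.1 hp).2
    (hcl _ (fun p hp => (Finset.mem_filter.1 hp).2) hpc))
    ⟨z, fun p hp => hzt p (Finset.mem_filter.1 hp).1⟩ fun x hx => htV fun p hp => ?_
  by_cases hpB : p.1 ∈ B
  · exact hx.1 p (Finset.mem_filter.2 ⟨hp, hpB⟩)
  · exact hx.2 p (Finset.mem_filter.2 ⟨hp, hpB⟩)

/-- Disjoint open sets of `A → ℝ` have disjoint projections onto countably many coordinates. -/
theorem exists_countable_not_eqOn {A : Type*} {V W : Set (A → ℝ)} (hV : IsOpen V)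
    (hW : IsOpen W) (hVW : Disjoint V W) :
    ∃ B : Set A, B.Countable ∧ ∀ x ∈ V, ∀ y ∈ W, ¬ EqOn x y B := by
  classical
  obtain ⟨B, -, hBc, hB⟩ := exists_countable_freeIn hV countable_empty
  refine ⟨B, hBc, fun x hx y hy hxy => ?_⟩
  obtain ⟨t, htB, hxt, hfree⟩ := hB x hx
  obtain ⟨u, hyu, huW⟩ := exists_ratBox_subset hW hy
  obtain ⟨v, hv, ⟨w, hw⟩, hvV⟩ := hfree (B ∪ Prod.fst '' (u : Set (A × ℚ × ℚ)))
    (hBc.union (u.finite_toSet.image _).countable)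
  let z : A → ℝ := fun a => if ∃ p ∈ v, p.1 = a then w a else y a
  have hz : ∀ a, (∀ p ∈ v, p.1 ≠ a) → z a = y a := fun a ha =>
    if_neg (by push Not; exact ha)
  refine Set.disjoint_left.1 hVW (hvV (show z ∈ ratBox t ∩ ratBox v from ⟨?_, ?_⟩)) (huW ?_)
  · refine ratBox_congr (fun p hp => ?_) hxt
    rw [hxy (htB p hp)]
    exact hz _ fun q hq h => hv q hq (Or.inl (h ▸ htB p hp))
  · exact ratBox_congr (fun p hp => if_pos ⟨p, hp, rfl⟩) hw
  · refine ratBox_congr (fun p hp => ?_) hyu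
    exact hz _ fun q hq h => hv q hq (Or.inr ⟨p, hp, h.symm⟩)

/-- A continuous real function on a product of lines depends on countably many coordinates. -/
theorem exists_countable_dependsOn {A : Type*} {φ : (A → ℝ) → ℝ} (hφ : Continuous φ) :
    ∃ B : Set A, B.Countable ∧ ∀ x y, EqOn x y B → φ x = φ y := by
  have hex : ∀ q : ℚ, ∃ B : Set A, B.Countable ∧
      ∀ x ∈ {x | φ x < q}, ∀ y ∈ {y | (q : ℝ) < φ y}, ¬ EqOn x y B := fun q =>
    exists_countable_not_eqOn (isOpen_lt hφ continuous_const) (isOpen_lt continuous_const hφ)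
      (Set.disjoint_left.2 fun x (h : φ x < q) (h' : (q : ℝ) < φ x) => lt_asymm h h')
  choose B hB hsep using hex
  have hle : ∀ x y, EqOn x y (⋃ q, B q) → φ y ≤ φ x := by
    intro x y hxy
    by_contra! hlt
    obtain ⟨q, hq, hq'⟩ := exists_rat_btwn hlt
    exact hsep q x hq y hq' (hxy.mono (subset_iUnion B q))
  exact ⟨⋃ q, B q, countable_iUnion hB, fun x y h => le_antisymm (hle y x h.symm) (hle x y h)⟩

/-- Disjoint closed sets determined by countably many coordinates are functionally separated. -/
theorem functionallySeparated_of_countable_coords {A : Type*} {D : Set A} (hD : D.Countable)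
    {E F : Set (A → ℝ)} (hE : IsClosed E) (hF : IsClosed F) (hEF : Disjoint E F)
    (hED : ∀ x ∈ E, ∀ y, EqOn y x D → y ∈ E) (hFD : ∀ x ∈ F, ∀ y, EqOn y x D → y ∈ F) :
    FunctionallySeparated E F := by
  classical
  have : Countable D := hD.to_subtype
  let j : (D → ℝ) → A → ℝ := fun w a => if h : a ∈ D then w ⟨a, h⟩ else 0
  have hj : Continuous j := continuous_pi fun a => by
    by_cases h : a ∈ D
    · simpa [j, h] using continuous_apply (⟨a, h⟩ : D)
    · simpa [j, h] using continuous_const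
  have hjr : ∀ x : A → ℝ, EqOn (j fun a => x a) x D := fun x a ha => by simp [j, ha]
  obtain ⟨φ, h0, h1, h01⟩ := exists_continuous_zero_one_of_isClosed (hE.preimage hj)
    (hF.preimage hj) (hEF.preimage j)
  refine ⟨fun x => φ fun a => x a, by fun_prop, fun x => h01 _, fun x hx => ?_, fun x hx => ?_⟩
  · exact h0 (hED x hx _ (hjr x))
  · exact h1 (hFD x hx _ (hjr x))

/-- If an open set meets every fibre of every projection onto countably many coordinates, then
it contains a slice over a countable set of coordinates, functionally separated from its
complement. -/
theorem exists_slice_functionallySeparated {A : Type*} {V : Set (A → ℝ)} (hV : IsOpen V)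
    (hfib : ∀ B : Set A, B.Countable → ∀ y : A → ℝ, ∃ z ∈ V, EqOn z y B) {B₀ : Set A}
    (hB₀ : B₀.Countable) :
    ∃ (B : Set A) (c : A → ℝ), B₀ ⊆ B ∧
      FunctionallySeparated {x | ∀ a ∉ B, x a = c a} Vᶜ := by
  classical
  obtain ⟨B, hBB₀, hBc, hB⟩ := exists_countable_freeIn hV hB₀
  have hcov : ∀ y : A → ℝ, ∃ t, (∀ p ∈ t, p.1 ∈ B) ∧ y ∈ ratBox t ∧ FreeIn V t := by
    intro y
    obtain ⟨z, hz, hzy⟩ := hfib B hBc y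
    obtain ⟨t, ht, hzt, hfree⟩ := hB z hz
    exact ⟨t, ht, ratBox_congr (fun p hp => (hzy (ht p hp)).symm) hzt, hfree⟩
  have hTc : {t | (∀ p ∈ t, p.1 ∈ B) ∧ FreeIn V t}.Countable :=
    (countable_setOf_supported hBc).mono fun t ht => ht.1
  obtain ⟨t, ht⟩ := hTc.exists_eq_range <| by
    obtain ⟨t, h, -, h'⟩ := hcov 0
    exact ⟨t, h, h'⟩
  have htT : ∀ n, (∀ p ∈ t n, p.1 ∈ B) ∧ FreeIn V (t n) := fun n => ht.ge (mem_range_self n)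
  have hex : ∀ n (C : Set A), ∃ u : Finset (A × ℚ × ℚ), ∃ w : A → ℝ, C.Countable →
      (∀ p ∈ u, p.1 ∉ C) ∧ w ∈ ratBox u ∧ ratBox (t n) ∩ ratBox u ⊆ V := by
    intro n C
    by_cases hC : C.Countable
    · obtain ⟨u, hu, ⟨w, hw⟩, huV⟩ := (htT n).2 C hC
      exact ⟨u, w, fun _ => ⟨hu, hw, huV⟩⟩
    · exact ⟨∅, 0, fun h => absurd h hC⟩
  choose u w huw using hex
  let D : ℕ → Set A := fun n =>
    Nat.rec B (fun n C => C ∪ Prod.fst '' (u n C : Set (A × ℚ × ℚ))) n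
  have hDc : ∀ n, (D n).Countable := by
    intro n
    induction n with
    | zero => exact hBc
    | succ n ih => exact ih.union (((u n (D n)).finite_toSet.image _).countable)
  have hDm : Monotone D := monotone_nat_of_le_succ fun n => subset_union_left
  have hmem : ∀ n, ∀ p ∈ u n (D n), p.1 ∈ D (n + 1) := fun n p hp => Or.inr ⟨p, hp, rfl⟩
  have hnot : ∀ n, ∀ p ∈ u n (D n), p.1 ∉ D n := fun n => (huw n (D n) (hDc n)).1
  have huniq : ∀ m n, ∀ p ∈ u m (D m), ∀ q ∈ u n (D n), p.1 = q.1 → m = n := by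
    intro m n p hp q hq h
    rcases lt_trichotomy m n with hlt | heq | hlt
    · exact absurd (hDm hlt (hmem m p hp)) (h ▸ hnot n q hq)
    · exact heq
    · exact absurd (hDm hlt (hmem n q hq)) (h ▸ hnot m p hp)
  let c : A → ℝ := fun a =>
    if h : ∃ n, ∃ p ∈ u n (D n), p.1 = a then w h.choose (D h.choose) a else 0
  have hc : ∀ n, c ∈ ratBox (u n (D n)) := by
    intro n
    refine ratBox_congr (fun p hp => ?_) (huw n (D n) (hDc n)).2.1
    have h : ∃ m, ∃ q ∈ u m (D m), q.1 = p.1 := ⟨n, p, hp, rfl⟩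
    obtain ⟨q, hq, hqp⟩ := h.choose_spec
    have hm : h.choose = n := huniq _ _ q hq p hp hqp
    simp only [c, dif_pos h, hm]
  let U : Set (A → ℝ) := ⋃ n, ratBox (t n) ∩ ratBox (u n (D n))
  have hUV : U ⊆ V := iUnion_subset fun n => (huw n (D n) (hDc n)).2.2
  let E : Set (A → ℝ) := {x | ∀ a ∈ (⋃ n, D n) \ B, x a = c a}
  have hBD : B ⊆ ⋃ n, D n := subset_iUnion D 0
  have hsep : FunctionallySeparated E Uᶜ := by
    refine functionallySeparated_of_countable_coords (countable_iUnion hDc) ?_ ?_ ?_ ?_ ?_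
    · have : E = ⋂ a ∈ (⋃ n, D n) \ B, {x | x a = c a} := by ext x; simp [E]
      rw [this]
      exact isClosed_biInter fun a _ => isClosed_eq (continuous_apply a) continuous_const
    · exact (isOpen_iUnion fun n => (isOpen_ratBox _).inter (isOpen_ratBox _)).isClosed_compl
    · refine disjoint_compl_right_iff_subset.2 fun x hx => ?_
      obtain ⟨s, hs, hxs, hfree⟩ := hcov x
      obtain ⟨n, rfl⟩ := ht.le (show s ∈ {t | (∀ p ∈ t, p.1 ∈ B) ∧ FreeIn V t} from ⟨hs, hfree⟩)
      refine mem_iUnion.2 ⟨n, hxs, ratBox_congr (fun p hp => hx _ ⟨?_, fun h => ?_⟩) (hc n)⟩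
      · exact mem_iUnion.2 ⟨n + 1, hmem n p hp⟩
      · exact hnot n p hp (hDm (Nat.zero_le n) h)
    · intro x hx y hyx a ha
      rw [hyx ha.1, hx a ha]
    · intro x hx y hyx hy
      obtain ⟨n, hn, hn'⟩ := mem_iUnion.1 hy
      refine hx (mem_iUnion.2 ⟨n, ratBox_congr (fun p hp => ?_) hn,
        ratBox_congr (fun p hp => ?_) hn'⟩)
      · exact (hyx (hBD ((htT n).1 p hp))).symm
      · exact (hyx (mem_iUnion.2 ⟨n + 1, hmem n p hp⟩)).symm
  obtain ⟨φ, hφ, h01, h0, h1⟩ := hsep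
  exact ⟨B, c, hBB₀, φ, hφ, h01, fun x hx => h0 x fun a ha => hx a ha.2,
    fun x hx => h1 x fun h => hx (hUV h)⟩

theorem isGδ_setOf_eqOn {A : Type*} {B : Set A} (hB : B.Countable) (y : A → ℝ) :
    IsGδ {x : A → ℝ | EqOn x y B} := by
  have h : {x : A → ℝ | EqOn x y B} = ⋂ a ∈ B, (fun x : A → ℝ => x a) ⁻¹' {y a} := by
    ext x; simp [EqOn]
  rw [h]
  exact .biInter hB fun a _ => (IsGδ.singleton (y a)).preimage (continuous_apply a)

/-- A `Gδ` set in a product of lines contains, with each of its points, a fibre of the projection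
onto countably many coordinates. -/
theorem IsGδ.exists_countable_eqOn {A : Type*} {S : Set (A → ℝ)} (hS : IsGδ S) {x : A → ℝ}
    (hx : x ∈ S) : ∃ B : Set A, B.Countable ∧ ∀ y, EqOn y x B → y ∈ S := by
  obtain ⟨T, hT, hTc, rfl⟩ := hS
  have hex : ∀ U : Set (A → ℝ), ∃ t, U ∈ T → x ∈ ratBox t ∧ ratBox t ⊆ U := by
    intro U
    by_cases hU : U ∈ T
    · obtain ⟨t, ht⟩ := exists_ratBox_subset (hT U hU) (hx U hU)
      exact ⟨t, fun _ => ht⟩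
    · exact ⟨∅, fun h => absurd h hU⟩
  choose t ht using hex
  refine ⟨⋃ U ∈ T, Prod.fst '' (t U : Set (A × ℚ × ℚ)),
    hTc.biUnion fun U _ => ((t U).finite_toSet.image _).countable, fun y hy U hU => ?_⟩
  exact (ht U hU).2 (ratBox_congr
    (fun p hp => hy (mem_biUnion hU ⟨p, hp, rfl⟩)) (ht U hU).1)

/-- The cover of `A → ℝ` by the open slabs of half-width `ε` around integer multiples of `ε` in
the coordinate `a`. -/
def slabCover {A : Type*} (a : A) (ε : ℝ) : Set (Set (A → ℝ)) :=
  range fun k : ℤ => {x | |x a - k * ε| < ε}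

theorem isCFOCover_slabCover {A : Type*} (a : A) {ε : ℝ} (hε : 0 < ε) :
    IsCFOCover (slabCover a ε) := by
  refine ⟨countable_range _, ?_, ?_⟩
  · rintro _ ⟨k, rfl⟩
    refine ⟨fun x => max (ε - |x a - k * ε|) 0, by fun_prop, ?_⟩
    ext x
    simp
  · refine eq_univ_of_forall fun x => ⟨_, ⟨⌊x a / ε⌋, rfl⟩, ?_⟩
    have h1 := (le_div_iff₀ hε).1 (Int.floor_le (x a / ε))
    have h2 := (div_lt_iff₀ hε).1 (Int.lt_floor_add_one (x a / ε))
    simp only [mem_ofPred_eq]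
    rw [abs_lt]
    constructor <;> linarith

theorem UClose.abs_sub_lt {X A : Type*} {a : A} {ε : ℝ} {f g : X → A → ℝ}
    (h : UClose (slabCover a ε) f g) (x : X) : |f x a - g x a| < 2 * ε := by
  obtain ⟨_, ⟨k, rfl⟩, hf, hg⟩ := h x
  simp only [mem_ofPred_eq, abs_lt] at hf hg ⊢
  constructor <;> linarith [hf.1, hf.2, hg.1, hg.2]

theorem countable_iff_mk_lt_aleph_one {α : Type*} {s : Set α} :
    s.Countable ↔ Cardinal.mk s < Cardinal.aleph 1 := by
  rw [← Cardinal.succ_aleph0, Order.lt_succ_iff, Cardinal.le_aleph0_iff_set_countable]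

theorem ZTauSet.eq_empty_of_isGδ {A : Type} {Z : Set (A → ℝ)}
    (hZ : ZTauSet (Cardinal.aleph 1) Z) {S : Set (A → ℝ)} (hSZ : S ⊆ Z) (hS : IsGδ S) :
    S = ∅ := by
  by_contra hne
  obtain ⟨x, hx⟩ := nonempty_iff_ne_empty.2 hne
  obtain ⟨B, hBc, hB⟩ := hS.exists_countable_eqOn hx
  have hpos : ∀ n : ℕ, (0 : ℝ) < 1 / (n + 1) := fun n => Nat.one_div_pos_of_nat
  obtain ⟨f, -, hfg, φ, -, -, h0, h1⟩ := hZ.2 id continuous_id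
    (⋃ a ∈ B, range fun n : ℕ => slabCover a (1 / (n + 1)))
    (countable_iff_mk_lt_aleph_one.1 (hBc.biUnion fun a _ => countable_range _)) (by
      intro 𝒰 h𝒰
      obtain ⟨a, -, n, rfl⟩ := mem_iUnion₂.1 h𝒰
      exact isCFOCover_slabCover a (hpos n))
  have hfx : f x ∈ Z := hSZ <| hB _ fun a ha => by
    by_contra hfa
    obtain ⟨n, hn⟩ := exists_nat_one_div_lt (half_pos (abs_pos.2 (sub_ne_zero.2 hfa)))
    have := (hfg _ (mem_biUnion ha (mem_range_self n))).abs_sub_lt x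
    simp only [id] at this
    linarith
  exact zero_ne_one ((h0 _ (mem_range_self x)).symm.trans (h1 _ hfx))

theorem FunctionallyOpen.exists_countable_eqOn {A : Type*} {U : Set (A → ℝ)}
    (hU : FunctionallyOpen U) :
    ∃ B : Set A, B.Countable ∧ ∀ x ∈ U, ∀ y, EqOn y x B → y ∈ U := by
  obtain ⟨φ, hφ, rfl⟩ := hU
  obtain ⟨B, hBc, hB⟩ := exists_countable_dependsOn hφ
  refine ⟨B, hBc, fun x hx y hyx => ?_⟩
  rwa [mem_preimage, hB y x hyx]

theorem zTauSet_of_isGδ_eq_empty {A : Type} {Z : Set (A → ℝ)} (hZcl : IsClosed Z)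
    (hZ : ∀ S : Set (A → ℝ), S ⊆ Z → IsGδ S → S = ∅) : ZTauSet (Cardinal.aleph 1) Z := by
  classical
  refine ⟨hZcl, fun g hg 𝒞 h𝒞 hcov => ?_⟩
  have h𝒞c : 𝒞.Countable := countable_iff_mk_lt_aleph_one.2 h𝒞
  have hex : ∀ U : Set (A → ℝ), ∃ B : Set A, B.Countable ∧
      (FunctionallyOpen U → ∀ x ∈ U, ∀ y, EqOn y x B → y ∈ U) := by
    intro U
    by_cases hU : FunctionallyOpen U
    · obtain ⟨B, hB, h⟩ := hU.exists_countable_eqOn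
      exact ⟨B, hB, fun _ => h⟩
    · exact ⟨∅, countable_empty, fun h => absurd h hU⟩
  choose b hb hbU using hex
  obtain ⟨B, c, hB, φ, hφ, h01, h0, h1⟩ := exists_slice_functionallySeparated hZcl.isOpen_compl
    (fun B hBc y => by
      by_contra! hno
      have := hZ {x | EqOn x y B} (fun x hx => by_contra fun h => hno x h hx)
        (isGδ_setOf_eqOn hBc y)
      exact this.le (show y ∈ {x | EqOn x y B} from fun _ _ => rfl))
    (h𝒞c.biUnion fun 𝒰 h𝒰 => (hcov 𝒰 h𝒰).1.biUnion fun U _ => hb U)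
  refine ⟨fun x a => if a ∈ B then g x a else c a, continuous_pi fun a => ?_,
    fun 𝒰 h𝒰 x => ?_, φ, hφ, h01, ?_, fun z hz => h1 z fun h => h hz⟩
  · by_cases ha : a ∈ B
    · simpa [ha, Function.comp_def] using (continuous_apply a).comp hg
    · simpa [ha] using continuous_const
  · obtain ⟨U, hU, hgU⟩ : g x ∈ ⋃₀ 𝒰 := (hcov 𝒰 h𝒰).2.2 ▸ mem_univ _
    refine ⟨U, hU, hbU U ((hcov 𝒰 h𝒰).2.1 U hU) _ hgU _ fun a ha => ?_, hgU⟩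
    exact if_pos (hB (mem_biUnion h𝒰 (mem_biUnion hU ha)))
  · rintro _ ⟨x, rfl⟩
    exact h0 _ fun a ha => if_neg ha

/-- A closed subset of `ℝ^{ω₁}` is a `Z_{ω₁}`-set iff it contains no nonempty
`G_δ`-subset of `ℝ^{ω₁}`. -/
theorem Z_omega1_set_iff_no_Gdelta
    (A : Type) (hA : Cardinal.mk A = Cardinal.aleph 1)
    (Z : Set (A → ℝ)) (hZcl : IsClosed Z) :
    ZTauSet (Cardinal.aleph 1) Z ↔
      ∀ S : Set (A → ℝ), S ⊆ Z → IsGδ S → S = ∅ := by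
  exact ⟨fun hZ _ hSZ hS => hZ.eq_empty_of_isGδ hSZ hS, zTauSet_of_isGδ_eq_empty hZcl⟩
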